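/- Let V be any vertex algebra. If V is C_2-cofinite, then V is E_n-cofinite and C_{n+2}-cofinite for every n ≥ 0; that is, dim V/E_n(V) < ∞ and dim V/C_{n+2}(V) < ∞ for all n ≥ 0. -/

import Mathlib

open scoped DirectSum

noncomputable section


/-- Integer binomial coefficient `C(m, i)` for `m : ℤ`, `i : ℕ`. -/
def intBinom (m : ℤ) (i : ℕ) : ℤ :=
  (∏ j ∈ Finset.range i, (m - (j : ℤ))) / (i.factorial : ℤ)

/-- A vertex algebra over `ℂ`: a complex vector space `V` with a vacuum vector and a
linear state-field correspondence `Y`, `Y(v,x) = ∑ₙ vₙ x^{-n-1}`, satisfying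
truncation, vacuum and creation properties, and Borcherds' commutator and
iterate formulas. -/
structure VertexAlgebra (V : Type*) [AddCommGroup V] [Module ℂ V] where
  /-- the coefficients of vertex operators: `Y u n v = uₙ v`. -/
  Y : V →ₗ[ℂ] ℤ → Module.End ℂ V
  /-- the vacuum vector `𝟏`. -/
  vac : V
  trunc : ∀ u v : V, ∃ N : ℕ, ∀ n : ℤ, (N : ℤ) ≤ n → Y u n v = 0
  vac_act : ∀ (n : ℤ) (v : V), Y vac n v = if n = -1 then v else 0
  create : ∀ u : V, Y u (-1) vac = u
  create_nonneg : ∀ (u : V) (n : ℤ), 0 ≤ n → Y u n vac = 0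
  commutator : ∀ (u v w : V) (m n : ℤ),
    Y u m (Y v n w) - Y v n (Y u m w)
      = ∑ᶠ i : ℕ, intBinom m i • Y (Y u i v) (m + n - i) w
  iterate : ∀ (u v w : V) (m n : ℤ),
    Y (Y u m v) n w
      = ∑ᶠ i : ℕ, ((-1 : ℤ) ^ i * intBinom m i) •
          (Y u (m - i) (Y v (n + i) w)
            - ((((-1 : ℤˣ) ^ m : ℤˣ) : ℤ) • Y v (m + n - i) (Y u i w)))

/-- A module for a vertex algebra. -/
structure VAModule {V : Type*} [AddCommGroup V] [Module ℂ V] (va : VertexAlgebra V)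
    (W : Type*) [AddCommGroup W] [Module ℂ W] where
  /-- the action `act v n w = vₙ w`. -/
  act : V →ₗ[ℂ] ℤ → Module.End ℂ W
  trunc : ∀ (v : V) (w : W), ∃ N : ℕ, ∀ n : ℤ, (N : ℤ) ≤ n → act v n w = 0
  vac_act : ∀ (n : ℤ) (w : W), act va.vac n w = if n = -1 then w else 0
  commutator : ∀ (u v : V) (w : W) (m n : ℤ),
    act u m (act v n w) - act v n (act u m w)
      = ∑ᶠ i : ℕ, intBinom m i • act (va.Y u i v) (m + n - i) w
  iterate : ∀ (u v : V) (w : W) (m n : ℤ),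
    act (va.Y u m v) n w
      = ∑ᶠ i : ℕ, ((-1 : ℤ) ^ i * intBinom m i) •
          (act u (m - i) (act v (n + i) w)
            - ((((-1 : ℤˣ) ^ m : ℤˣ) : ℤ) • act v (m + n - i) (act u i w)))

variable {V : Type*} [AddCommGroup V] [Module ℂ V]

/-- The adjoint module of a vertex algebra. -/
def VertexAlgebra.adjoint (va : VertexAlgebra V) : VAModule va V where
  act := va.Y
  trunc := va.trunc
  vac_act := va.vac_act
  commutator := va.commutator
  iterate := va.iterate

variable {W : Type*} [AddCommGroup W] [Module ℂ W]

/-- `Efilt M n = E_n(W)`: the subspace of `W` spanned by the vectors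
`u⁽¹⁾_{-1-k₁} ⋯ u⁽ʳ⁾_{-1-k_r} w` for `r ≥ 1`, `u⁽ⁱ⁾ ∈ V`, `w ∈ W`, `kᵢ ≥ 0`,
`k₁ + ⋯ + k_r ≥ n`. -/
def Efilt {va : VertexAlgebra V} (M : VAModule va W) (n : ℤ) : Submodule ℂ W :=
  Submodule.span ℂ {x : W | ∃ (L : List (V × ℕ)) (w : W), L ≠ [] ∧
    n ≤ (L.map fun p => ((p.2 : ℤ))).sum ∧
    x = L.foldr (fun p acc => M.act p.1 (-1 - (p.2 : ℤ)) acc) w}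

/-- `Cfilt M n = C_n(W)`: the subspace of `W` spanned by the vectors `v_{-n} w`. -/
def Cfilt {va : VertexAlgebra V} (M : VAModule va W) (n : ℕ) : Submodule ℂ W :=
  Submodule.span ℂ {x : W | ∃ (v : V) (w : W), x = M.act v (-(n : ℤ)) w}

/-- The binomial coefficient of a negative integer does not vanish. -/
theorem intBinom_ne_zero {m : ℤ} (hm : m < 0) (i : ℕ) : intBinom m i ≠ 0 := by
  have habs : (i.factorial : ℤ) ≤ |∏ j ∈ Finset.range i, (m - (j : ℤ))| := by
    rw [Finset.abs_prod, ← Finset.prod_range_add_one_eq_factorial]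
    push_cast
    refine Finset.prod_le_prod (fun j _ => by positivity) fun j _ => ?_
    rw [abs_of_neg (by omega)]
    omega
  have hpos : (0 : ℤ) < i.factorial := by exact_mod_cast i.factorial_pos
  intro h
  unfold intBinom at h
  generalize (∏ j ∈ Finset.range i, (m - (j : ℤ))) = a at *
  have h1 := Int.emod_nonneg a hpos.ne'
  have h2 := Int.emod_lt_of_pos a hpos
  have h3 := Int.emod_add_mul_ediv a (i.factorial : ℤ)
  rw [h, mul_zero, add_zero] at h3
  rw [h3] at h1 h2
  rw [abs_of_nonneg h1] at habs
  omega

theorem Submodule.mem_of_zsmul_mem (S : Submodule ℂ W) {c : ℤ} (hc : c ≠ 0) {x : W}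
    (h : c • x ∈ S) : x ∈ S := by
  rw [← Int.cast_smul_eq_zsmul ℂ] at h
  exact (S.smul_mem_iff (Int.cast_ne_zero.mpr hc)).mp h

theorem Submodule.finsum_mem' (S : Submodule ℂ W) {f : ℕ → W} (h : ∀ i, f i ∈ S) :
    ∑ᶠ i, f i ∈ S :=
  finsum_induction (· ∈ S) S.zero_mem (fun _ _ => S.add_mem) h

/-- If a finitely supported sum and all its terms but one lie in a submodule, so does the
remaining term. -/
theorem Submodule.mem_of_finsum_mem (S : Submodule ℂ W) {f : ℕ → W} (r : ℕ)
    (hf : f.support.Finite) (hsum : ∑ᶠ i, f i ∈ S) (h : ∀ i, i ≠ r → f i ∈ S) : f r ∈ S := by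
  have key : f r + ∑ i ∈ hf.toFinset.erase r, f i = ∑ᶠ i, f i := by
    rw [finsum_eq_sum_of_support_subset f (s := insert r hf.toFinset) (by
      intro i hi
      simp [Function.mem_support.mp hi])]
    rw [← Finset.add_sum_erase (insert r hf.toFinset) f (Finset.mem_insert_self _ _),
      Finset.erase_insert_eq_erase]
  rw [← key] at hsum
  exact (S.add_mem_iff_left (S.sum_mem fun i hi => h i (Finset.ne_of_mem_erase hi))).mp hsum

/-- A submodule has finite-dimensional quotient iff it has a finitely generated supplement. -/
theorem Submodule.finiteDimensional_quotient_iff (S : Submodule ℂ W) :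
    FiniteDimensional ℂ (W ⧸ S) ↔ ∃ F : Submodule ℂ W, F.FG ∧ F ⊔ S = ⊤ := by
  constructor
  · intro h
    obtain ⟨F, hF⟩ := S.exists_isCompl
    refine ⟨F, ?_, hF.symm.sup_eq_top⟩
    exact Module.Finite.iff_fg.mp (Module.Finite.equiv (S.quotientEquivOfIsCompl F hF))
  · rintro ⟨F, hF, hFS⟩
    refine ⟨?_⟩
    have : F.map S.mkQ = ⊤ := by
      rw [← S.range_mkQ, LinearMap.range_eq_map, ← hFS, Submodule.map_sup]
      simp
    rw [← this]
    exact hF.map _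

namespace VAModule

/-- The total depth `k₁ + ⋯ + k_r`. -/
def depth {α : Type*} (L : List (α × ℕ)) : ℤ :=
  (L.map fun p => ((p.2 : ℤ))).sum

@[simp] theorem depth_nil {α : Type*} : depth ([] : List (α × ℕ)) = 0 := rfl

@[simp] theorem depth_cons {α : Type*} (p : α × ℕ) (L : List (α × ℕ)) :
    depth (p :: L) = p.2 + depth L := by
  simp [depth]

/-- A list with bounded entries and large depth splits into two lists of large depth. -/
theorem exists_append_of_depth {α : Type*} (K a b : ℕ) (L : List (α × ℕ)) (hK : ∀ p ∈ L, p.2 ≤ K)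
    (h : (a : ℤ) + b + K ≤ depth L) :
    ∃ L₁ L₂, L = L₁ ++ L₂ ∧ (a : ℤ) ≤ depth L₁ ∧ (b : ℤ) ≤ depth L₂ := by
  induction L generalizing a with
  | nil => exact ⟨[], [], rfl, by simp at h ⊢; omega, by simp at h ⊢; omega⟩
  | cons p t ih =>
    have hp := hK p (by simp)
    rcases Nat.eq_zero_or_pos a with rfl | ha
    · exact ⟨[], p :: t, rfl, by simp, by omega⟩
    rw [depth_cons] at h
    rcases le_or_gt a p.2 with hap | hap
    · exact ⟨[p], t, rfl, by simp; omega, by omega⟩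
    · obtain ⟨L₁, L₂, rfl, h₁, h₂⟩ := ih (a - p.2) (fun q hq => hK q (by simp [hq])) (by omega)
      exact ⟨p :: L₁, L₂, rfl, by simp; omega, h₂⟩

variable {va : VertexAlgebra V} (M : VAModule va W)

/-- The vector `u⁽¹⁾_{-1-k₁} ⋯ u⁽ʳ⁾_{-1-k_r} w`. -/
def word (L : List (V × ℕ)) (w : W) : W :=
  L.foldr (fun p acc => M.act p.1 (-1 - (p.2 : ℤ)) acc) w

@[simp] theorem word_nil (w : W) : M.word [] w = w := rfl

@[simp] theorem word_cons (p : V × ℕ) (L : List (V × ℕ)) (w : W) :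
    M.word (p :: L) w = M.act p.1 (-1 - (p.2 : ℤ)) (M.word L w) := rfl

@[simp] theorem word_zero (L : List (V × ℕ)) : M.word L 0 = 0 := by
  induction L with
  | nil => rfl
  | cons p t ih => simp [ih]

@[simp] theorem word_add (L : List (V × ℕ)) (x y : W) :
    M.word L (x + y) = M.word L x + M.word L y := by
  induction L with
  | nil => rfl
  | cons p t ih => simp [ih]

@[simp] theorem word_smul (L : List (V × ℕ)) (c : ℂ) (x : W) :
    M.word L (c • x) = c • M.word L x := by
  induction L with
  | nil => rfl
  | cons p t ih => simp [ih]

theorem word_append (L L' : List (V × ℕ)) (w : W) :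
    M.word (L ++ L') w = M.word L (M.word L' w) := by
  simp [word]

/-! ### The filtration `E` -/

theorem word_mem_Efilt (L : List (V × ℕ)) (w : W) {n : ℤ} (h : n ≤ depth L) :
    M.word L w ∈ Efilt M n := by
  refine Submodule.subset_span ⟨(va.vac, 0) :: L, w, by simp, ?_, ?_⟩
  · simpa [depth] using h
  · simp [word, M.vac_act]

theorem Efilt_eq_top {n : ℤ} (h : n ≤ 0) : Efilt M n = ⊤ :=
  eq_top_iff.mpr fun w _ => M.word_mem_Efilt [] w h

/-- Membership induction for `E_n` along words. -/
theorem Efilt_le {n : ℤ} {S : Submodule ℂ W}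
    (h : ∀ (L : List (V × ℕ)) (w : W), n ≤ depth L → M.word L w ∈ S) : Efilt M n ≤ S := by
  refine Submodule.span_le.mpr ?_
  rintro _ ⟨L, w, -, hL, rfl⟩
  exact h L w hL

theorem Efilt_anti {m n : ℤ} (h : m ≤ n) : Efilt M n ≤ Efilt M m :=
  M.Efilt_le fun L w hL => M.word_mem_Efilt L w (h.trans hL)

theorem act_commutator (u v : V) (w : W) (m n : ℤ) :
    M.act u m (M.act v n w) = M.act v n (M.act u m w)
      + ∑ᶠ i : ℕ, intBinom m i • M.act (va.Y u i v) (m + n - i) w := by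
  rw [← M.commutator, add_sub_cancel]

theorem act_creation_mem_Efilt (u : V) (k : ℕ) {n : ℤ} {x : W} (hx : x ∈ Efilt M n) :
    M.act u (-1 - (k : ℤ)) x ∈ Efilt M (n + k) := by
  have : Efilt M n ≤ (Efilt M (n + k)).comap (M.act u (-1 - (k : ℤ))) :=
    M.Efilt_le fun L w hL => M.word_mem_Efilt ((u, k) :: L) w (by simp; omega)
  exact this hx

theorem act_mem_Efilt (u : V) (m : ℤ) {n : ℤ} {x : W} (hx : x ∈ Efilt M n) :
    M.act u m x ∈ Efilt M (n - m - 1) := by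
  suffices h : ∀ (L : List (V × ℕ)) (w : W) (u : V) (m n : ℤ), n ≤ depth L →
      M.act u m (M.word L w) ∈ Efilt M (n - m - 1) from
    M.Efilt_le (S := (Efilt M (n - m - 1)).comap (M.act u m))
      (fun L w hL => h L w u m n hL) hx
  clear hx
  intro L w
  induction L with
  | nil =>
    intro u m n hn
    rcases lt_or_ge m 0 with hm | hm
    · obtain ⟨k, rfl⟩ : ∃ k : ℕ, m = -1 - (k : ℤ) := ⟨(-1 - m).toNat, by omega⟩
      have := M.act_creation_mem_Efilt u k (M.word_mem_Efilt [] w hn)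
      exact M.Efilt_anti (by omega) this
    · rw [M.Efilt_eq_top (by simp at hn; omega)]
      trivial
  | cons p t ih =>
    intro u m n hn
    rw [depth_cons] at hn
    rw [word_cons, act_commutator]
    refine add_mem ?_ (Submodule.finsum_mem' _ fun i => zsmul_mem ?_ _)
    · exact M.Efilt_anti (by omega)
        (M.act_creation_mem_Efilt p.1 p.2 (ih u m (n - p.2) (by omega)))
    · exact M.Efilt_anti (by omega) (ih _ _ (n - p.2) (by omega))

/-- Elements of `C₂(V)` raise the `E`-filtration by one more step. -/
theorem act_Cfilt_two_mem_Efilt {a : V} (ha : a ∈ Cfilt va.adjoint 2) (m : ℤ) {n : ℤ} {x : W}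
    (hx : x ∈ Efilt M n) : M.act a m x ∈ Efilt M (n - m) := by
  induction ha using Submodule.span_induction with
  | mem a ha =>
    obtain ⟨u, v, rfl⟩ := ha
    change M.act (va.Y u (-(2 : ℕ)) v) m x ∈ _
    rw [M.iterate]
    refine Submodule.finsum_mem' _ fun i => zsmul_mem (sub_mem ?_ (zsmul_mem ?_ _)) _
    · exact M.Efilt_anti (by push_cast; omega) (M.act_mem_Efilt u _ (M.act_mem_Efilt v _ hx))
    · exact M.Efilt_anti (by push_cast; omega) (M.act_mem_Efilt v _ (M.act_mem_Efilt u _ hx))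
  | zero => simp
  | add a b _ _ iha ihb => simpa using add_mem iha ihb
  | smul c a _ iha => simpa using Submodule.smul_mem _ c iha

/-- For `n ≥ 1`, the leftmost factor of a word spanning `E_n` may be taken of positive depth. -/
theorem Efilt_le_span {n : ℤ} (hn : 1 ≤ n) :
    Efilt M n ≤ Submodule.span ℂ {x : W | ∃ (u : V) (k : ℕ) (y : W), 1 ≤ k ∧
      y ∈ Efilt M (n - k) ∧ x = M.act u (-1 - (k : ℤ)) y} := by
  refine M.Efilt_le fun L w hL => ?_
  induction L with
  | nil => simp at hL; omega
  | cons p t ih =>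
    obtain ⟨u, k⟩ := p
    rw [depth_cons] at hL
    rw [word_cons]
    rcases Nat.eq_zero_or_pos k with rfl | hk
    · have ht := ih (by simpa using hL)
      generalize M.word t w = z at ht ⊢
      induction ht using Submodule.span_induction with
      | mem x hx =>
        obtain ⟨v, k, y, hk, hy, rfl⟩ := hx
        rw [act_commutator]
        refine add_mem ?_ (Submodule.finsum_mem' _ fun i => zsmul_mem ?_ _)
        · exact Submodule.subset_span
            ⟨v, k, _, hk, M.Efilt_anti (by simp) (M.act_mem_Efilt u _ hy), rfl⟩
        · refine Submodule.subset_span ⟨va.Y u i v, k + 1 + i, y, by omega,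
            M.Efilt_anti (by push_cast; omega) hy, ?_⟩
          rw [show -1 - (0 : ℕ) + (-1 - (k : ℤ)) - i = -1 - ((k + 1 + i : ℕ) : ℤ) by
            push_cast; ring]
      | zero => simp
      | add a b _ _ iha ihb => simpa using add_mem iha ihb
      | smul c a _ iha => simpa using Submodule.smul_mem _ c iha
    · exact Submodule.subset_span ⟨u, k, _, hk, M.word_mem_Efilt t w (by simp at hL; omega), rfl⟩

theorem finiteDimensional_quotient_Efilt
    (hV : FiniteDimensional ℂ (V ⧸ Cfilt va.adjoint 2))
    (hW : FiniteDimensional ℂ (W ⧸ Efilt M 1)) (n : ℕ) :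
    FiniteDimensional ℂ (W ⧸ Efilt M n) := by
  obtain ⟨A, hA, hAC⟩ := (Submodule.finiteDimensional_quotient_iff _).mp hV
  induction n with
  | zero =>
    rw [Submodule.finiteDimensional_quotient_iff]
    exact ⟨⊥, Submodule.fg_bot, by simp [M.Efilt_eq_top]⟩
  | succ n ih =>
    rcases Nat.eq_zero_or_pos n with rfl | hn
    · simpa using hW
    rw [Submodule.finiteDimensional_quotient_iff] at ih ⊢
    obtain ⟨F, hF, hFE⟩ := ih
    let f : ℕ → V →ₗ[ℂ] W →ₗ[ℂ] W := fun k =>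
      (LinearMap.proj (-1 - (k : ℤ)) : (ℤ → Module.End ℂ W) →ₗ[ℂ] Module.End ℂ W) ∘ₗ M.act
    refine ⟨F ⊔ ⨆ k ∈ Finset.Icc 1 n, Submodule.map₂ (f k) A F,
      hF.sup (Submodule.fg_biSup _ _ fun k _ => hA.map₂ _ hF), ?_⟩
    set G := (F ⊔ ⨆ k ∈ Finset.Icc 1 n, Submodule.map₂ (f k) A F) ⊔ Efilt M ((n + 1 : ℕ) : ℤ)
      with hG
    have hEG : Efilt M ((n + 1 : ℕ) : ℤ) ≤ G := le_sup_right
    have hFG : F ≤ G := le_sup_left.trans le_sup_left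
    rw [eq_top_iff, ← hFE]
    refine sup_le hFG ((M.Efilt_le_span (by omega)).trans (Submodule.span_le.mpr ?_))
    rintro _ ⟨u, k, y, hk, hy, rfl⟩
    obtain ⟨a, ha, c, hc, rfl⟩ := Submodule.mem_sup.mp (hAC ▸ Submodule.mem_top : u ∈ A ⊔ _)
    obtain ⟨z, hz, e, he, rfl⟩ := Submodule.mem_sup.mp (hFE ▸ Submodule.mem_top : y ∈ F ⊔ _)
    have h1 : M.act c (-1 - (k : ℤ)) (z + e) ∈ G :=
      hEG (M.Efilt_anti (by push_cast; omega) (M.act_Cfilt_two_mem_Efilt hc _ hy))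
    have h2 : M.act a (-1 - (k : ℤ)) e ∈ G :=
      hEG (M.Efilt_anti (by push_cast; omega) (M.act_mem_Efilt a _ he))
    have h3 : M.act a (-1 - (k : ℤ)) z ∈ G := by
      rcases le_or_gt k n with hkn | hkn
      · refine (le_sup_right.trans le_sup_left : _ ≤ G) ?_
        refine (le_iSup₂_of_le k (Finset.mem_Icc.mpr ⟨hk, hkn⟩) le_rfl :
          Submodule.map₂ (f k) A F ≤ _) ?_
        exact Submodule.apply_mem_map₂ (f k) ha hz
      · have hz0 : z ∈ Efilt M 0 := by simp [M.Efilt_eq_top]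
        exact hEG (M.Efilt_anti (by push_cast; omega) (M.act_mem_Efilt a _ hz0))
    have : M.act (a + c) (-1 - (k : ℤ)) (z + e) = M.act a (-1 - (k : ℤ)) z
        + M.act a (-1 - (k : ℤ)) e + M.act c (-1 - (k : ℤ)) (z + e) := by
      simp
    rw [SetLike.mem_coe, this]
    exact add_mem (add_mem h3 h2) h1

/-! ### The filtration `C` -/

theorem act_neg_mem_Cfilt {n : ℕ} (hn : 1 ≤ n) (u : V) {m : ℤ} (hm : m ≤ -n) (w : W) :
    M.act u m w ∈ Cfilt M n := by
  obtain ⟨d, rfl⟩ : ∃ d : ℕ, m = -(n : ℤ) - d := ⟨(-n - m).toNat, by omega⟩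
  clear hm
  induction d generalizing u with
  | zero => exact Submodule.subset_span ⟨u, w, by simp⟩
  | succ d ih =>
    have key := M.iterate u va.vac w (-2) (-(n : ℤ) - d)
    rw [finsum_eq_single _ (n + d - 1)] at key
    · rw [M.vac_act, M.vac_act, if_pos (by omega), if_neg (by omega), smul_zero, sub_zero] at key
      have hmem := ih (va.Y u (-2) va.vac)
      rw [key] at hmem
      convert Submodule.mem_of_zsmul_mem _
        (mul_ne_zero (by simp) (intBinom_ne_zero (by norm_num) _)) hmem using 3
      push_cast [hn, (by omega : 1 ≤ n + d)]
      ring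
    · intro i hi
      rw [M.vac_act, M.vac_act, if_neg (by omega), if_neg (by omega)]
      simp

theorem act_creation_mem_Cfilt {n : ℕ} (hn : 1 ≤ n) (u : V) {m : ℤ} (hm : m < 0) {x : W}
    (hx : x ∈ Cfilt M n) : M.act u m x ∈ Cfilt M n := by
  suffices Cfilt M n ≤ (Cfilt M n).comap (M.act u m) from this hx
  refine Submodule.span_le.mpr ?_
  rintro _ ⟨v, w, rfl⟩
  rw [SetLike.mem_coe, Submodule.mem_comap, act_commutator]
  exact add_mem (M.act_neg_mem_Cfilt hn v le_rfl _) (Submodule.finsum_mem' _ fun i =>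
    zsmul_mem (M.act_neg_mem_Cfilt hn _ (by omega) w) _)

/-- A word with a factor `u_{-1-k}`, `k ≥ n`, lies in `C_{n+1}`. -/
theorem word_mem_Cfilt {n : ℕ} (L : List (V × ℕ)) (w : W) {p : V × ℕ} (hp : p ∈ L)
    (hpn : n ≤ p.2) : M.word L w ∈ Cfilt M (n + 1) := by
  induction L with
  | nil => simp at hp
  | cons q t ih =>
    rw [word_cons]
    rcases List.mem_cons.mp hp with rfl | hp
    · exact M.act_neg_mem_Cfilt (by omega) _ (by push_cast; omega) _
    · exact M.act_creation_mem_Cfilt (by omega) _ (by omega) (ih hp)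

/-- Words commute with `v_{-n}` modulo `C_{n+1}`. -/
theorem word_act_sub_mem_Cfilt (n : ℕ) (L : List (V × ℕ)) (v : V) (w : W) :
    M.word L (M.act v (-(n : ℤ)) w) - M.act v (-(n : ℤ)) (M.word L w) ∈ Cfilt M (n + 1) := by
  induction L with
  | nil => simp
  | cons p t ih =>
    have h1 := M.act_creation_mem_Cfilt (by omega) p.1 (m := -1 - (p.2 : ℤ)) (by omega) ih
    have h2 := M.commutator p.1 v (M.word t w) (-1 - (p.2 : ℤ)) (-(n : ℤ))
    have h3 : ∑ᶠ i : ℕ, intBinom (-1 - (p.2 : ℤ)) i •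
        M.act (va.Y p.1 i v) (-1 - (p.2 : ℤ) + -(n : ℤ) - i) (M.word t w) ∈ Cfilt M (n + 1) :=
      Submodule.finsum_mem' _ fun i =>
        zsmul_mem (M.act_neg_mem_Cfilt (by omega) _ (by push_cast; omega) _) _
    rw [← h2] at h3
    rw [map_sub] at h1
    simpa using add_mem h1 h3

/-- For `n ≥ 2`, a product `u_{-n} v_{-n}` maps into `C_{n+1}`. -/
theorem act_act_mem_Cfilt {n : ℕ} (hn : 2 ≤ n) (u v : V) (w : W) :
    M.act u (-(n : ℤ)) (M.act v (-(n : ℤ)) w) ∈ Cfilt M (n + 1) := by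
  have hit := M.iterate u v w (-1) (1 - 2 * n)
  have hL : M.act (va.Y u (-1) v) (1 - 2 * n) w ∈ Cfilt M (n + 1) :=
    M.act_neg_mem_Cfilt (by omega) _ (by push_cast; omega) _
  rw [hit] at hL
  have hsecond : ∀ i : ℕ, M.act v (-1 + (1 - 2 * n) - i) (M.act u i w) ∈ Cfilt M (n + 1) :=
    fun i => M.act_neg_mem_Cfilt (by omega) _ (by push_cast; omega) _
  have hr := Submodule.mem_of_finsum_mem _ (n - 1) ?_ hL ?_
  · have := Submodule.mem_of_zsmul_mem _
      (mul_ne_zero (by simp) (intBinom_ne_zero (by norm_num) _)) hr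
    have := (Submodule.sub_mem_iff_left _ (zsmul_mem (hsecond _) _)).mp this
    rwa [show (-1 : ℤ) - ((n - 1 : ℕ) : ℤ) = -n by omega,
      show (1 - 2 * n : ℤ) + ((n - 1 : ℕ) : ℤ) = -n by omega] at this
  · obtain ⟨N₁, h₁⟩ := M.trunc v w
    obtain ⟨N₂, h₂⟩ := M.trunc u w
    refine (Set.finite_lt_nat (N₁ + N₂ + 2 * n)).subset fun i hi => ?_
    by_contra hcon
    rw [Set.mem_ofPred_eq] at hcon
    apply hi
    simp only
    rw [h₁ _ (by omega), h₂ _ (by omega)]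
    simp
  · intro i hi
    refine zsmul_mem (sub_mem ?_ (zsmul_mem (hsecond i) _)) _
    rcases lt_or_ge i n with h | h
    · exact M.act_creation_mem_Cfilt (by omega) _ (by omega)
        (M.act_neg_mem_Cfilt (by omega) _ (by push_cast; omega) _)
    · exact M.act_neg_mem_Cfilt (by omega) _ (by push_cast; omega) _

theorem word_mem_of_Cfilt {n : ℕ} {S : Submodule ℂ W} (L : List (V × ℕ))
    (h : ∀ (v : V) (w : W), M.word L (M.act v (-(n : ℤ)) w) ∈ S) {x : W} (hx : x ∈ Cfilt M n) :
    M.word L x ∈ S := by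
  induction hx using Submodule.span_induction with
  | mem x hx =>
    obtain ⟨v, w, rfl⟩ := hx
    exact h v w
  | zero => simp
  | add a b _ _ iha ihb => simpa using add_mem iha ihb
  | smul c a _ iha => simpa using Submodule.smul_mem _ c iha

/-- Each `C_{n+2}` contains some `E_m`. -/
theorem exists_Efilt_le_Cfilt (n : ℕ) : ∃ m : ℕ, Efilt M m ≤ Cfilt M (n + 2) := by
  induction n with
  | zero =>
    refine ⟨1, M.Efilt_le fun L w hL => ?_⟩
    obtain ⟨p, hp, hp1⟩ : ∃ p ∈ L, 1 ≤ p.2 := by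
      by_contra! hcon
      have : depth L = 0 := List.sum_eq_zero (by
        intro x hx
        obtain ⟨p, hp, rfl⟩ := List.mem_map.mp hx
        have := hcon p hp
        omega)
      omega
    exact M.word_mem_Cfilt L w hp hp1
  | succ n ih =>
    obtain ⟨m, hm⟩ := ih
    refine ⟨m + m + (n + 2), M.Efilt_le fun L w hL => ?_⟩
    by_cases hbig : ∃ p ∈ L, n + 2 ≤ p.2
    · obtain ⟨p, hp, hpn⟩ := hbig
      exact M.word_mem_Cfilt L w hp hpn
    push Not at hbig
    obtain ⟨L₁, L₂, rfl, h₁, h₂⟩ := exists_append_of_depth (n + 2) m m L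
      (fun p hp => (hbig p hp).le) (by push_cast at hL ⊢; omega)
    rw [word_append]
    refine M.word_mem_of_Cfilt L₁ (fun v w' => ?_) (hm (M.word_mem_Efilt L₂ w h₂))
    have hmem : M.word L₁ w' ∈ Cfilt M (n + 2) := hm (M.word_mem_Efilt L₁ w' h₁)
    suffices Cfilt M (n + 2) ≤ (Cfilt M (n + 2 + 1)).comap (M.act v (-((n + 2 : ℕ) : ℤ))) from
      (Submodule.sub_mem_iff_left _ (show _ ∈ Cfilt M (n + 2 + 1) from this hmem)).mp
        (M.word_act_sub_mem_Cfilt (n + 2) L₁ v w')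
    refine Submodule.span_le.mpr ?_
    rintro _ ⟨u, y, rfl⟩
    exact M.act_act_mem_Cfilt (by omega) v u y

end VAModule

/-- **Proposition 4.4 (pfinite-prop).** Let `V` be any vertex algebra. If `V` is
`C₂`-cofinite, then `V` is `E_n`-cofinite and `C_{n+2}`-cofinite for every `n ≥ 0`. -/
theorem stmt16 {V : Type*} [AddCommGroup V] [Module ℂ V] (va : VertexAlgebra V)
    (h2 : FiniteDimensional ℂ (V ⧸ Cfilt va.adjoint 2)) :
    ∀ n : ℕ, FiniteDimensional ℂ (V ⧸ Efilt va.adjoint (n : ℤ)) ∧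
      FiniteDimensional ℂ (V ⧸ Cfilt va.adjoint (n + 2)) := by
  have hle : Cfilt va.adjoint 2 ≤ Efilt va.adjoint 1 := by
    refine Submodule.span_le.mpr ?_
    rintro _ ⟨u, w, rfl⟩
    exact va.adjoint.word_mem_Efilt [(u, 1)] w (by simp)
  have cofinite_mono {S T : Submodule ℂ V} (hST : S ≤ T) (hS : FiniteDimensional ℂ (V ⧸ S)) :
      FiniteDimensional ℂ (V ⧸ T) :=
    Module.Finite.of_surjective (Submodule.factor hST) (Submodule.factor_surjective hST)
  have hE := va.adjoint.finiteDimensional_quotient_Efilt h2 (cofinite_mono hle h2)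
  intro n
  obtain ⟨m, hm⟩ := va.adjoint.exists_Efilt_le_Cfilt n
  exact ⟨hE n, cofinite_mono hm (hE m)⟩

end
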